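/- arXiv:1402.6984 — 4 statements merged into one kernel-verified Lean document; each statement's English description precedes it below -/
import Mathlib

section
/- In the localization R of [2] at the morphism 0→2, the endomorphism set Hom_R(p(1), p(1)) has exactly two elements: the identity, and the endomorphism t := p(0→1) ∘ p(0→2)⁻¹ ∘ p(1→2); moreover t ∘ t = t and t ≠ id. -/
open CategoryTheory Topology unitInterval
open scoped Topology.Homotopy

noncomputable section

/-- The morphism property on `[2] = (0 ⟶ 1 ⟶ 2)` consisting of the morphism `0 ⟶ 2`. -/
def locW : MorphismProperty (Fin 3) := fun x y _ => x = 0 ∧ y = 2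

/-- The localization `R` of `[2]` at the morphism `0 ⟶ 2`. -/
abbrev LocR := locW.Localization

/-- The localization functor `p : [2] ⟶ R`. -/
abbrev locp : Fin 3 ⥤ LocR := locW.Q

/-- The morphism `0 ⟶ 1` in `[2]`. -/
abbrev hom01 : (0 : Fin 3) ⟶ 1 := homOfLE (by decide)

/-- The morphism `1 ⟶ 2` in `[2]`. -/
abbrev hom12 : (1 : Fin 3) ⟶ 2 := homOfLE (by decide)

/-- The morphism `0 ⟶ 2` in `[2]`. -/
abbrev hom02 : (0 : Fin 3) ⟶ 2 := homOfLE (by decide)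


def locInv : locp.obj 2 ⟶ locp.obj 0 :=
  (Localization.Construction.wIso (W := locW) hom02 ⟨rfl, rfl⟩).inv

lemma locInv_left : locp.map hom02 ≫ locInv = 𝟙 (locp.obj 0) :=
  (Localization.Construction.wIso (W := locW) hom02 ⟨rfl, rfl⟩).hom_inv_id

lemma locInv_right : locInv ≫ locp.map hom02 = 𝟙 (locp.obj 2) :=
  (Localization.Construction.wIso (W := locW) hom02 ⟨rfl, rfl⟩).inv_hom_id

lemma loc_comp : locp.map hom01 ≫ locp.map hom12 = locp.map hom02 := by
  rw [← Functor.map_comp]; rfl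

/-- canonical morphisms to `p 0` -/
def locU : (i : Fin 3) → (locp.obj i ⟶ locp.obj 0)
  | 0 => 𝟙 _
  | 1 => locp.map hom12 ≫ locInv
  | 2 => locInv

/-- canonical morphisms from `p 0` -/
def locV : (i : Fin 3) → (locp.obj 0 ⟶ locp.obj i)
  | 0 => 𝟙 _
  | 1 => locp.map hom01
  | 2 => locp.map hom02

lemma locV_locU (i : Fin 3) : locV i ≫ locU i = 𝟙 _ := by
  fin_cases i
  · exact Category.comp_id _
  · change locp.map hom01 ≫ locp.map hom12 ≫ locInv = _
    rw [← Category.assoc, loc_comp, locInv_left]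
  · exact locInv_left

/-- every object of the localization is canonically `p i` -/
def locIdx (X : LocR) : Fin 3 := (Localization.Construction.objEquiv locW).symm X

def locU' (X : LocR) : X ⟶ locp.obj 0 := locU (locIdx X)
def locV' (X : LocR) : locp.obj 0 ⟶ X := locV (locIdx X)

lemma locV_locU' (X : LocR) : locV' X ≫ locU' X = 𝟙 _ := locV_locU (locIdx X)

def locP : MorphismProperty LocR := fun X Y f =>
  f = locU' X ≫ locV' Y ∨ ∃ h : X = Y, f = eqToHom h

instance : locP.IsStableUnderComposition where
  comp_mem {X Y Z} f g hf hg := by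
    rcases hf with rfl | ⟨rfl, rfl⟩
    · rcases hg with rfl | ⟨rfl, rfl⟩
      · left
        rw [Category.assoc, ← Category.assoc (locV' Y), locV_locU', Category.id_comp]
      · left; simp
    · simpa using hg

lemma locP_top : locP = ⊤ := by
  apply Localization.Construction.morphismProperty_eq_top
  · intro i j f
    have hij := leOfHom f
    fin_cases i <;> fin_cases j
    · right; exact ⟨rfl, locW.Q.map_id _⟩
    · left; exact (Category.id_comp _).symm
    · left; exact (Category.id_comp _).symm
    · exact absurd hij (by decide)
    · right; exact ⟨rfl, locW.Q.map_id _⟩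
    · left
      change locp.map hom12 = (locp.map hom12 ≫ locInv) ≫ locp.map hom02
      rw [Category.assoc, locInv_right, Category.comp_id]
    · exact absurd hij (by decide)
    · exact absurd hij (by decide)
    · right; exact ⟨rfl, locW.Q.map_id _⟩
  · rintro i j w ⟨rfl, rfl⟩
    left
    exact (Category.comp_id _).symm

def locF : Fin 3 ⥤ Type :=
  ComposableArrows.mk₂ (X₀ := PUnit) (X₁ := Bool) (X₂ := PUnit)
    (↾ fun _ => true) (↾ fun _ => PUnit.unit)

lemma locF_inv : locW.IsInvertedBy locF := by
  rintro i j w ⟨rfl, rfl⟩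
  rw [isIso_iff_bijective]
  constructor
  · intro a b _
    exact Subsingleton.elim (α := PUnit) a b
  · intro b
    exact ⟨PUnit.unit, Subsingleton.elim (α := PUnit) _ _⟩

lemma loc_ne (x : locp.obj 2 ⟶ locp.obj 1) : locp.map hom12 ≫ x ≠ 𝟙 (locp.obj 1) := by
  intro h
  have h' := congrArg (Localization.Construction.lift locF locF_inv).map h
  rw [Functor.map_comp, CategoryTheory.Functor.map_id] at h'
  have h1 : ∀ b : Bool, (Localization.Construction.lift locF locF_inv).map x PUnit.unit = b :=
    fun b => ConcreteCategory.congr_hom h' b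
  exact Bool.noConfusion ((h1 true).symm.trans (h1 false))

/-- in the localization `R` of `[2]` at `0 ⟶ 2`, the endomorphism set of
`p(1)` has exactly two elements, the identity and the idempotent
`t = p(0 ⟶ 1) ∘ p(0 ⟶ 2)⁻¹ ∘ p(1 ⟶ 2)`, with `t ∘ t = t` and `t ≠ id`. -/
theorem stmt_11 :
    ∃ inv02 : locp.obj 2 ⟶ locp.obj 0,
      locp.map hom02 ≫ inv02 = 𝟙 (locp.obj 0) ∧
      inv02 ≫ locp.map hom02 = 𝟙 (locp.obj 2) ∧
      ∃ t : locp.obj 1 ⟶ locp.obj 1,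
        t = locp.map hom12 ≫ inv02 ≫ locp.map hom01 ∧
        t ≫ t = t ∧ t ≠ 𝟙 (locp.obj 1) ∧
        ∀ s : locp.obj 1 ⟶ locp.obj 1, s = 𝟙 (locp.obj 1) ∨ s = t := by
  refine ⟨locInv, locInv_left, locInv_right, _, rfl, ?_, ?_, ?_⟩
  · have := locV_locU 1
    change locp.map hom01 ≫ locp.map hom12 ≫ locInv = _ at this
    have h2 := congrArg (fun z => locp.map hom12 ≫ locInv ≫ z ≫ locp.map hom01) this
    simpa only [Category.assoc, Category.id_comp] using h2
  · exact loc_ne _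
  · intro s
    have hs : locP s := by rw [locP_top]; trivial
    rcases hs with hs | ⟨_, hs⟩
    · right
      exact hs.trans (Category.assoc _ _ _)
    · left; exact hs
end
end

section
/- There is an isomorphism of categories φ : R → R with φ ∘ φ = id which interchanges the objects p(0) and p(2) and fixes the object p(1); in particular, the localization R of [2] at 0→2 admits a nontrivial involutive automorphism. -/
open CategoryTheory Topology unitInterval
open scoped Topology.Homotopy

noncomputable section

lemma conj_refl {X Y : LocR} (f : X ⟶ Y) (hX : X = X) (hY : Y = Y) :
    eqToHom hX ≫ f ≫ eqToHom hY = f := by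
  simp

open Localization.Construction in
/-- `p(0 ⟶ 2)` as an isomorphism. -/
def isoH : locp.obj 0 ≅ locp.obj 2 := wIso hom02 ⟨rfl, rfl⟩

lemma isoH_hom : isoH.hom = locp.map hom01 ≫ locp.map hom12 := by
  rw [← Functor.map_comp]; rfl

/-- The functor on `[2]` inducing the involution. -/
def swapG : Fin 3 ⥤ LocR :=
  ComposableArrows.mk₂ (isoH.inv ≫ locp.map hom01) (locp.map hom12 ≫ isoH.inv)

lemma swapG_01 : swapG.map hom01 = isoH.inv ≫ locp.map hom01 := rfl

lemma swapG_12 : swapG.map hom12 = locp.map hom12 ≫ isoH.inv := rfl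

lemma swapG_02 : swapG.map hom02 = isoH.inv := by
  have : hom02 = hom01 ≫ hom12 := rfl
  rw [this, Functor.map_comp, swapG_01, swapG_12]
  have h := isoH_hom
  calc (isoH.inv ≫ locp.map hom01) ≫ locp.map hom12 ≫ isoH.inv
      = isoH.inv ≫ (locp.map hom01 ≫ locp.map hom12) ≫ isoH.inv := by
        simp only [Category.assoc]
    _ = isoH.inv := by rw [← h]; simp

lemma swapG_inv : locW.IsInvertedBy swapG := by
  rintro x y f ⟨rfl, rfl⟩
  have : f = hom02 := Subsingleton.elim _ _
  rw [this, swapG_02]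
  exact Iso.isIso_inv isoH

/-- The involution. -/
def swapF : LocR ⥤ LocR := Localization.Construction.lift swapG swapG_inv

lemma swapF_map {x y : Fin 3} (f : x ⟶ y) : swapF.map (locp.map f) = swapG.map f := by
  have := Functor.congr_hom (Localization.Construction.fac swapG swapG_inv) f
  exact this.trans (conj_refl (swapG.map f) rfl rfl)

lemma swapF_hom : swapF.map isoH.hom = isoH.inv :=
  (swapF_map hom02).trans swapG_02

lemma swapF_inv : swapF.map isoH.inv = isoH.hom := by
  have h1 : swapF.map isoH.inv ≫ swapF.map isoH.hom = 𝟙 _ := by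
    rw [← Functor.map_comp, Iso.inv_hom_id]
    exact swapF.map_id _
  rw [swapF_hom] at h1
  exact (Iso.comp_inv_eq_id isoH).1 h1

lemma swapF_swapF : swapF ⋙ swapF = 𝟭 LocR := by
  apply Localization.Construction.uniq
  refine ComposableArrows.ext₂ (f := locp ⋙ swapF ⋙ swapF) (g := locp ⋙ 𝟭 _) rfl rfl rfl ?_ ?_
  · refine Eq.trans ?_ (conj_refl (locp.map hom01) rfl rfl).symm
    change swapF.map (swapF.map (locp.map hom01)) = locp.map hom01
    rw [swapF_map, swapG_01]
    refine (swapF.map_comp _ _).trans ?_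
    refine (congrArg₂ (fun (a : locp.obj 0 ⟶ locp.obj 2) (b : locp.obj 2 ⟶ locp.obj 1) => a ≫ b)
      swapF_inv ((swapF_map hom01).trans swapG_01)).trans ?_
    exact isoH.hom_inv_id_assoc _
  · refine Eq.trans ?_ (conj_refl (locp.map hom12) rfl rfl).symm
    change swapF.map (swapF.map (locp.map hom12)) = locp.map hom12
    rw [swapF_map, swapG_12]
    refine (swapF.map_comp _ _).trans ?_
    refine (congrArg₂ (fun (a : locp.obj 1 ⟶ locp.obj 0) (b : locp.obj 0 ⟶ locp.obj 2) => a ≫ b)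
      ((swapF_map hom12).trans swapG_12) swapF_inv).trans ?_
    refine (Category.assoc _ _ _).trans ?_
    exact (congrArg (locp.map hom12 ≫ ·) isoH.inv_hom_id).trans (Category.comp_id _)

/-- the localization `R` of `[2]` at `0 ⟶ 2` admits an involutive
automorphism interchanging `p(0)` and `p(2)` and fixing `p(1)`. -/
theorem stmt_12 :
    ∃ φ : LocR ⥤ LocR,
      φ ⋙ φ = 𝟭 LocR ∧
      φ.obj (locp.obj 0) = locp.obj 2 ∧
      φ.obj (locp.obj 2) = locp.obj 0 ∧
      φ.obj (locp.obj 1) = locp.obj 1 := 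
  ⟨swapF, swapF_swapF, rfl, rfl, rfl⟩
end
end

section
/- Let u : A → B be a fully faithful functor of small categories, a₀ an object of A, and let u' : A' → B' be the one-point extension of u at a₀ (attaching the new morphism either at its source or at its target), with inclusions j_A : A → A' and j_B : B → B'. Let C be a category with all small limits. Then u' is fully faithful, and a functor Y' : B' → C lies in the essential image of the (pointwise) right Kan extension functor Ran_{u'} : Fun(A', C) → Fun(B', C) — equivalently, the unit Y' → Ran_{u'}(Y' ∘ u') is an isomorphism — if and only if the restriction Y' ∘ j_B : B → C lies in the essential image of Ran_u : Fun(A, C) → Fun(B, C). -/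
open CategoryTheory Topology unitInterval
open scoped Topology.Homotopy

noncomputable section

namespace OnePoint

variable (A : Type) [SmallCategory A]

/-- The one-point extension of `A` at `a₀` attaching a new morphism at its target:
`none` is the new object `a₋₁` and `some` embeds `A`. -/
def ExtTgt (_a₀ : A) : Type := Option A

/-- The one-point extension of `A` at `a₀` attaching a new morphism at its source:
`none` is the new object `a₁` and `some` embeds `A`. -/
def ExtSrc (_a₀ : A) : Type := Option A

variable (a₀ : A)

instance : SmallCategory (ExtTgt A a₀) where
  Hom x y :=
    match x, y with
    | some x, some y => x ⟶ y
    | none, some y => a₀ ⟶ y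
    | none, none => PUnit
    | some _, none => PEmpty
  id x :=
    match x with
    | some x => 𝟙 x
    | none => PUnit.unit
  comp {x y z} f g :=
    match x, y, z, f, g with
    | some _, some _, some _, f, g => f ≫ g
    | none, some _, some _, f, g => f ≫ g
    | none, none, some _, _, g => g
    | none, none, none, _, _ => PUnit.unit
    | some _, none, some _, f, _ => f.elim
    | some _, none, none, f, _ => f.elim
    | some _, some _, none, _, g => g.elim
    | none, some _, none, _, g => g.elim
  id_comp {x y} f := by
    cases x <;> cases y <;> first | exact f.elim | rfl | exact Category.id_comp f
  comp_id {x y} f := by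
    cases x <;> cases y <;> first | exact f.elim | rfl | exact Category.comp_id f
  assoc {x y z w} f g h := by
    cases x <;> cases y <;> cases z <;> cases w <;>
      first | exact f.elim | exact g.elim | exact h.elim | rfl | exact Category.assoc f g h

instance : SmallCategory (ExtSrc A a₀) where
  Hom x y :=
    match x, y with
    | some x, some y => x ⟶ y
    | some x, none => x ⟶ a₀
    | none, none => PUnit
    | none, some _ => PEmpty
  id x :=
    match x with
    | some x => 𝟙 x
    | none => PUnit.unit
  comp {x y z} f g :=
    match x, y, z, f, g with
    | some _, some _, some _, f, g => f ≫ g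
    | some _, some _, none, f, g => f ≫ g
    | some _, none, none, f, _ => f
    | none, none, none, _, _ => PUnit.unit
    | none, some _, _, f, _ => f.elim
    | some _, none, some _, _, g => g.elim
    | none, none, some _, _, g => g.elim
  id_comp {x y} f := by
    cases x <;> cases y <;> first | exact f.elim | rfl | exact Category.id_comp f
  comp_id {x y} f := by
    cases x <;> cases y <;> first | exact f.elim | rfl | exact Category.comp_id f
  assoc {x y z w} f g h := by
    cases x <;> cases y <;> cases z <;> cases w <;>
      first | exact f.elim | exact g.elim | exact h.elim | rfl | exact Category.assoc f g h

/-- The fully faithful inclusion `j_A : A ⟶ A'` (target case). -/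
def jTgt : A ⥤ ExtTgt A a₀ where
  obj x := some x
  map f := f
  map_id _ := rfl
  map_comp _ _ := rfl

/-- The fully faithful inclusion `j_A : A ⟶ A'` (source case). -/
def jSrc : A ⥤ ExtSrc A a₀ where
  obj x := some x
  map f := f
  map_id _ := rfl
  map_comp _ _ := rfl

/-- The new object `a₋₁` in the target case. -/
def ExtTgt.star : ExtTgt A a₀ := none

/-- The new object `a₁` in the source case. -/
def ExtSrc.star : ExtSrc A a₀ := none

/-- The new morphism `f : a₋₁ ⟶ a₀` in the target case. -/
def newTgt : ExtTgt.star A a₀ ⟶ (jTgt A a₀).obj a₀ := 𝟙 a₀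

/-- The new morphism `f : a₀ ⟶ a₁` in the source case. -/
def newSrc : (jSrc A a₀).obj a₀ ⟶ ExtSrc.star A a₀ := 𝟙 a₀

end OnePoint

namespace OnePoint

variable {A B : Type} [SmallCategory A] [SmallCategory B]

/-- The one-point extension of a functor `u : A ⟶ B` at `a₀ : A` (target case): it agrees
with `u` on `A` and sends the new object and new morphism of `A'` to the new object and
new morphism of `B'`. -/
def extTgt (u : A ⥤ B) (a₀ : A) : ExtTgt A a₀ ⥤ ExtTgt B (u.obj a₀) where
  obj x := Option.map u.obj x
  map {x y} f :=
    match x, y, f with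
    | some _, some _, f => u.map f
    | none, some _, f => u.map f
    | none, none, _ => PUnit.unit
    | some _, none, f => f.elim
  map_id x := by cases x <;> first | rfl | exact u.map_id _
  map_comp {x y z} f g := by
    cases x <;> cases y <;> cases z <;>
      first | exact f.elim | exact g.elim | rfl | exact u.map_comp f g

/-- The one-point extension of a functor `u : A ⟶ B` at `a₀ : A` (source case). -/
def extSrc (u : A ⥤ B) (a₀ : A) : ExtSrc A a₀ ⥤ ExtSrc B (u.obj a₀) where
  obj x := Option.map u.obj x
  map {x y} f :=
    match x, y, f with
    | some _, some _, f => u.map f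
    | some _, none, f => u.map f
    | none, none, _ => PUnit.unit
    | none, some _, f => f.elim
  map_id x := by cases x <;> first | rfl | exact u.map_id _
  map_comp {x y z} f g := by
    cases x <;> cases y <;> cases z <;>
      first | exact f.elim | exact g.elim | rfl | exact u.map_comp f g

end OnePoint

namespace OnePointAux

universe v' u'

variable {A B : Type} [SmallCategory A] [SmallCategory B]
  {C : Type u'} [Category.{v'} C]

/-- Elementary form of: `Y` is, at `b`, the pointwise right Kan extension along `u` of its
restriction. -/
def Loc (u : A ⥤ B) (Y : B ⥤ C) (b : B) : Prop :=
  ∀ (T : C) (φ : ∀ a : A, (b ⟶ u.obj a) → (T ⟶ Y.obj (u.obj a))),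
    (∀ (a a' : A) (h : a ⟶ a') (g : b ⟶ u.obj a),
      φ a' (g ≫ u.map h) = φ a g ≫ Y.map (u.map h)) →
    ∃! f : T ⟶ Y.obj b, ∀ (a : A) (g : b ⟶ u.obj a), f ≫ Y.map g = φ a g

lemma loc_obj (u : A ⥤ B) [u.Full] (Y : B ⥤ C) (a : A) : Loc u Y (u.obj a) := by
  intro T φ hφ
  refine ⟨φ a (𝟙 _), ?_, ?_⟩
  · intro a' g
    obtain ⟨h, rfl⟩ := u.map_surjective g
    rw [← hφ, Category.id_comp]
  · intro f hf
    have := hf a (𝟙 _)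
    simpa using this

/-- The canonical right extension. -/
abbrev ext (u : A ⥤ B) (Y : B ⥤ C) : u.RightExtension (u ⋙ Y) :=
  Functor.RightExtension.mk Y (𝟙 (u ⋙ Y))

lemma loc_iff (u : A ⥤ B) (Y : B ⥤ C) (b : B) :
    Loc u Y b ↔ Nonempty ((ext u Y).IsPointwiseRightKanExtensionAt b) := by
  constructor
  · intro H
    have key : ∀ s : Limits.Cone (StructuredArrow.proj b u ⋙ u ⋙ Y),
        ∃! f : s.pt ⟶ Y.obj b, ∀ (a : A) (g : b ⟶ u.obj a),
          f ≫ Y.map g = s.π.app (StructuredArrow.mk g) := by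
      intro s
      apply H s.pt (fun a g => s.π.app (StructuredArrow.mk g))
      intro a a' h g
      exact (s.w (StructuredArrow.homMk h rfl :
        StructuredArrow.mk g ⟶ StructuredArrow.mk (g ≫ u.map h))).symm
    refine ⟨{ lift := fun s => (key s).choose, fac := ?_, uniq := ?_ }⟩
    · intro s j
      have := (key s).choose_spec.1 j.right j.hom
      refine Eq.trans ?_ this
      exact congrArg _ (Category.comp_id _)
    · intro s m hm
      apply (key s).choose_spec.2
      intro a g
      have := hm (StructuredArrow.mk g)
      refine Eq.trans ?_ this
      exact congrArg _ (Category.comp_id _).symm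
  · rintro ⟨H⟩ T φ hφ
    let s : Limits.Cone (StructuredArrow.proj b u ⋙ u ⋙ Y) :=
      { pt := T
        π := { app := fun j => φ j.right j.hom
               naturality := fun i j f => by
                have h1 := hφ _ _ f.right i.hom
                rw [StructuredArrow.w f] at h1
                exact (Category.id_comp _).trans h1 } }
    refine ⟨H.lift s, ?_, ?_⟩
    · intro a g
      have := H.fac s (StructuredArrow.mk g)
      refine Eq.trans ?_ this
      exact congrArg _ (Category.comp_id _).symm
    · intro f hf
      refine H.uniq s f ?_
      intro j
      refine Eq.trans ?_ (hf j.right j.hom)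
      exact congrArg _ (Category.comp_id _)

lemma mem_iff [Limits.HasLimitsOfSize.{0, 0} C] (u : A ⥤ B) [u.Full] [u.Faithful] (Y : B ⥤ C) :
    (u.ran (H := C)).essImage Y ↔ ∀ b, Loc u Y b := by
  have hff := (u.ranAdjunction C).fullyFaithfulROfIsIsoCounit
  have := hff.full
  have := hff.faithful
  rw [← (u.ranAdjunction C).isIso_unit_app_iff_mem_essImage,
    Functor.isIso_ranAdjunction_unit_app_iff]
  constructor
  · intro h b
    rw [loc_iff]
    exact ⟨Functor.isPointwiseRightKanExtensionOfIsRightKanExtension Y (𝟙 (u ⋙ Y)) b⟩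
  · intro h
    have H : (ext u Y).IsPointwiseRightKanExtension := fun b => ((loc_iff u Y b).1 (h b)).some
    exact H.isRightKanExtension

open OnePoint

variable (u : A ⥤ B) (a₀ : A)

lemma tgt_full [u.Full] : (extTgt u a₀).Full where
  map_surjective {x y} f := by
    cases x <;> cases y
    · exact ⟨PUnit.unit, rfl⟩
    · exact u.map_surjective f
    · exact f.elim
    · exact u.map_surjective f

lemma tgt_faithful [u.Faithful] : (extTgt u a₀).Faithful where
  map_injective {x y} f g h := by
    cases x <;> cases y
    · rfl
    · exact u.map_injective h
    · exact f.elim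
    · exact u.map_injective h

lemma src_full [u.Full] : (extSrc u a₀).Full where
  map_surjective {x y} f := by
    cases x <;> cases y
    · exact ⟨PUnit.unit, rfl⟩
    · exact f.elim
    · exact u.map_surjective f
    · exact u.map_surjective f

lemma src_faithful [u.Faithful] : (extSrc u a₀).Faithful where
  map_injective {x y} f g h := by
    cases x <;> cases y
    · rfl
    · exact f.elim
    · exact u.map_injective h
    · exact u.map_injective h

lemma tgt_loc (Y : ExtTgt B (u.obj a₀) ⥤ C) (b : B) :
    Loc (extTgt u a₀) Y ((jTgt B (u.obj a₀)).obj b) ↔ Loc u (jTgt B (u.obj a₀) ⋙ Y) b := by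
  constructor
  · intro H T φ hφ
    obtain ⟨f, hf, hu⟩ := H T
      (fun a g => match a, g with
        | Option.some a, g => φ a g
        | Option.none, g => PEmpty.elim g)
      (by
        intro a a' h g
        cases a <;> cases a'
        · exact PEmpty.elim g
        · exact PEmpty.elim g
        · exact PEmpty.elim h
        · exact hφ _ _ h g)
    refine ⟨f, fun a g => hf (Option.some a) g, fun f' hf' => hu f' ?_⟩
    intro a g
    cases a
    · exact PEmpty.elim g
    · exact hf' _ g
  · intro H T φ hφ
    obtain ⟨f, hf, hu⟩ := H T (fun a g => φ (Option.some a) g)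
      (fun a a' h g => hφ (Option.some a) (Option.some a') h g)
    refine ⟨f, ?_, fun f' hf' => hu f' (fun a g => hf' (Option.some a) g)⟩
    intro a g
    cases a
    · exact PEmpty.elim g
    · exact hf _ g

lemma src_fac {b₀ b : B} (Y : ExtSrc B b₀ ⥤ C) (g : b ⟶ b₀) {T : C}
    (f : T ⟶ Y.obj ((jSrc B b₀).obj b)) :
    f ≫ Y.map (show (jSrc B b₀).obj b ⟶ ExtSrc.star B b₀ from g) =
      (f ≫ Y.map ((jSrc B b₀).map g)) ≫ Y.map (newSrc B b₀) := by
  have h : (show (jSrc B b₀).obj b ⟶ ExtSrc.star B b₀ from g) =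
    (jSrc B b₀).map g ≫ newSrc B b₀ := (Category.comp_id g).symm
  refine (congrArg (fun k => f ≫ Y.map k) h).trans ?_
  simp only [Y.map_comp, Category.assoc]

lemma src_loc (Y : ExtSrc B (u.obj a₀) ⥤ C) (b : B) :
    Loc (extSrc u a₀) Y ((jSrc B (u.obj a₀)).obj b) ↔ Loc u (jSrc B (u.obj a₀) ⋙ Y) b := by
  constructor
  · intro H T φ hφ
    obtain ⟨f, hf, hu⟩ := H T
      (fun a g => match a, g with
        | Option.some a, g => φ a g
        | Option.none, g => φ a₀ g ≫ Y.map (newSrc B (u.obj a₀)))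
      (by
        intro a a' h g
        cases a with
        | none =>
          cases a' with
          | none =>
            have : (extSrc u a₀).map h = 𝟙 ((extSrc u a₀).obj none) := rfl
            rw [this, Y.map_id, Category.comp_id, Category.comp_id]
          | some a' => exact PEmpty.elim h
        | some a =>
          cases a' with
          | none =>
            have h1 := hφ a a₀ h g
            exact (congrArg (· ≫ Y.map (newSrc B (u.obj a₀))) h1).trans
              (src_fac Y (u.map h) (φ a g)).symm
          | some a' => exact hφ _ _ h g)
    refine ⟨f, fun a g => hf (Option.some a) g, fun f' hf' => hu f' ?_⟩
    intro a g
    cases a with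
    | none =>
      have h1 := hf' a₀ g
      exact (src_fac Y g f').trans (congrArg (· ≫ Y.map (newSrc B (u.obj a₀))) h1)
    | some a => exact hf' _ g
  · intro H T φ hφ
    obtain ⟨f, hf, hu⟩ := H T (fun a g => φ (Option.some a) g)
      (fun a a' h g => hφ (Option.some a) (Option.some a') h g)
    refine ⟨f, ?_, fun f' hf' => hu f' (fun a g => hf' (Option.some a) g)⟩
    intro a g
    cases a with
    | none =>
      have h1 := hf a₀ g
      have h3 : (extSrc u a₀).map (newSrc A a₀) = newSrc B (u.obj a₀) := u.map_id a₀
      have h4 := hφ (Option.some a₀) none (newSrc A a₀) g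
      have h5 : (show b ⟶ u.obj a₀ from g) ≫ u.map (𝟙 a₀) = g := by
        rw [u.map_id]; exact Category.comp_id _
      refine (src_fac Y g f).trans ?_
      refine (congrArg (· ≫ Y.map (newSrc B (u.obj a₀))) h1).trans ?_
      refine Eq.trans ?_ (h4.symm.trans (congrArg (φ none) h5))
      exact congrArg (fun k => φ (Option.some a₀) g ≫ Y.map k) h3.symm
    | some a => exact hf _ g

end OnePointAux

/-- for a one-point extension `u' : A' ⟶ B'` of a fully faithful functor
`u : A ⟶ B` (in either orientation) and a category `C` with all small limits, `u'` is
fully faithful and a functor `Y' : B' ⟶ C` lies in the essential image of the right Kan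
extension functor along `u'` if and only if `Y' ∘ j_B` lies in the essential image of the
right Kan extension functor along `u`. -/
theorem stmt_18 {A B : Type} [SmallCategory A] [SmallCategory B] (u : A ⥤ B)
    [u.Full] [u.Faithful] (a₀ : A) (C : Type*) [Category C]
    [Limits.HasLimitsOfSize.{0, 0} C] :
    ((OnePoint.extTgt u a₀).Full ∧ (OnePoint.extTgt u a₀).Faithful ∧
      ∀ Y' : OnePoint.ExtTgt B (u.obj a₀) ⥤ C,
        ((OnePoint.extTgt u a₀).ran (H := C)).essImage Y' ↔
          (u.ran (H := C)).essImage (OnePoint.jTgt B (u.obj a₀) ⋙ Y')) ∧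
    ((OnePoint.extSrc u a₀).Full ∧ (OnePoint.extSrc u a₀).Faithful ∧
      ∀ Y' : OnePoint.ExtSrc B (u.obj a₀) ⥤ C,
        ((OnePoint.extSrc u a₀).ran (H := C)).essImage Y' ↔
          (u.ran (H := C)).essImage (OnePoint.jSrc B (u.obj a₀) ⋙ Y')) := by
  have := OnePointAux.tgt_full u a₀
  have := OnePointAux.tgt_faithful u a₀
  have := OnePointAux.src_full u a₀
  have := OnePointAux.src_faithful u a₀
  refine ⟨⟨inferInstance, inferInstance, fun Y' => ?_⟩, inferInstance, inferInstance,
    fun Y' => ?_⟩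
  · rw [OnePointAux.mem_iff, OnePointAux.mem_iff]
    refine ⟨fun h b => (OnePointAux.tgt_loc u a₀ Y' b).1 (h _), fun h b => ?_⟩
    cases b with
    | none => exact OnePointAux.loc_obj (OnePoint.extTgt u a₀) Y' none
    | some b => exact (OnePointAux.tgt_loc u a₀ Y' b).2 (h b)
  · rw [OnePointAux.mem_iff, OnePointAux.mem_iff]
    refine ⟨fun h b => (OnePointAux.src_loc u a₀ Y' b).1 (h _), fun h b => ?_⟩
    cases b with
    | none => exact OnePointAux.loc_obj (OnePoint.extSrc u a₀) Y' none
    | some b => exact (OnePointAux.src_loc u a₀ Y' b).2 (h b)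
end
end

section
/- Let u : A → B be a fully faithful functor of small categories, a₀ an object of A, and let u' : A' → B' be the one-point extension of u at a₀ (attaching the new morphism either at its source or at its target), with inclusions j_A : A → A' and j_B : B → B'. Let C be a category with all small colimits. Then u' is fully faithful, and a functor Y' : B' → C lies in the essential image of the (pointwise) left Kan extension functor Lan_{u'} : Fun(A', C) → Fun(B', C) — equivalently, the counit Lan_{u'}(Y' ∘ u') → Y' is an isomorphism — if and only if the restriction Y' ∘ j_B : B → C lies in the essential image of Lan_u : Fun(A, C) → Fun(B, C). -/
open CategoryTheory Topology unitInterval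
open scoped Topology.Homotopy

noncomputable section

namespace OnePointProof

open Limits Functor OnePoint

universe w₁ w₂

section general

variable {A B : Type} [SmallCategory A] [SmallCategory B]
variable {C : Type w₁} [Category.{w₂} C] [HasColimitsOfSize.{0, 0} C]

/-- Essential image of `lan` along a fully faithful functor, pointwise. -/
theorem essImage_lan_iff (u : A ⥤ B) [u.Full] [u.Faithful] (Y : B ⥤ C) :
    (u.lan (H := C)).essImage Y ↔
      ∀ b, Nonempty ((LeftExtension.mk Y (𝟙 (u ⋙ Y))).IsPointwiseLeftKanExtensionAt b) := by
  have hff : (u.lan (H := C)).FullyFaithful := (u.lanAdjunction C).fullyFaithfulLOfIsIsoUnit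
  have := hff.full
  have := hff.faithful
  rw [← (u.lanAdjunction C).isIso_counit_app_iff_mem_essImage,
    isIso_lanAdjunction_counit_app_iff]
  constructor
  · intro h b
    exact ⟨isPointwiseLeftKanExtensionOfIsLeftKanExtension Y (𝟙 (u ⋙ Y)) b⟩
  · intro h
    exact LeftExtension.IsPointwiseLeftKanExtension.isLeftKanExtension
      (E := LeftExtension.mk Y (𝟙 (u ⋙ Y))) (fun b => (h b).some)

theorem pointwise_at_image (u : A ⥤ B) [u.Full] [u.Faithful] (Y : B ⥤ C) (a : A) :
    Nonempty ((LeftExtension.mk Y (𝟙 (u ⋙ Y))).IsPointwiseLeftKanExtensionAt (u.obj a)) := by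
  refine ⟨IsColimit.ofIsoColimit
    (colimitOfDiagramTerminal (CostructuredArrow.mkIdTerminal (S := u) (Y := a)) _)
    (Cocone.ext (Iso.refl _) ?_)⟩
  intro j
  have h := CostructuredArrow.w
    ((CostructuredArrow.mkIdTerminal (S := u) (Y := a)).from j)
  have h' : u.map ((CostructuredArrow.mkIdTerminal (S := u) (Y := a)).from j).left = j.hom := by
    simpa using h
  refine (Category.comp_id _).trans ((congrArg Y.map h').trans ?_)
  exact (Category.id_comp (Y.map j.hom)).symm

end general

theorem comp_aux {D : Type} [SmallCategory D] {C : Type w₁} [Category.{w₂} C] (Y : D ⥤ C)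
    {p q : D} (g : p ⟶ q) :
    (𝟙 (Y.obj p) ≫ 𝟙 (Y.obj p) ≫ Y.map (𝟙 p) ≫ 𝟙 (Y.obj p)) ≫ Y.map g =
      𝟙 (Y.obj p) ≫ Y.map g := by
  simp

section sq

variable {A B A' B' : Type} [SmallCategory A] [SmallCategory B] [SmallCategory A']
  [SmallCategory B']
variable {C : Type w₁} [Category.{w₂} C] [HasColimitsOfSize.{0, 0} C]

theorem initial_of {T : A ⥤ A'} {L : A ⥤ B} {R : A' ⥤ B'} {S : B ⥤ B'}
    (w : TwoSquare T L R S) (X : A') (t : StructuredArrow X T) (ht : IsInitial t)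
    (ht' : IsInitial ((w.structuredArrowDownwards X).obj t)) :
    (w.structuredArrowDownwards X).Initial := by
  have h1 := initial_fromPUnit_of_isInitial ht
  have h2 := initial_fromPUnit_of_isInitial ht'
  have e : fromPUnit.{0} t ⋙ w.structuredArrowDownwards X ≅
      fromPUnit.{0} ((w.structuredArrowDownwards X).obj t) :=
    NatIso.ofComponents (fun _ => Iso.refl _) (fun f => ht'.hom_ext _ _)
  have h3 : (fromPUnit t ⋙ w.structuredArrowDownwards X).Initial := initial_of_natIso e.symm
  exact initial_of_initial_comp (fromPUnit t) _

theorem isInitial_of_existsUnique {T : A ⥤ A'} {X : A'} (t : StructuredArrow X T)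
    (h : ∀ (a : A) (f : X ⟶ T.obj a), ∃! g : t.right ⟶ a, t.hom ≫ T.map g = f) :
    Nonempty (IsInitial t) := by
  refine ⟨IsInitial.ofUniqueHom (fun s => StructuredArrow.homMk (h s.right s.hom).choose
    (h s.right s.hom).choose_spec.1) ?_⟩
  intro s m
  ext
  exact (h s.right s.hom).choose_spec.2 _ (StructuredArrow.w m)

theorem initial_of' {T : A ⥤ A'} {L : A ⥤ B} {R : A' ⥤ B'} {S : B ⥤ B'}
    (w : TwoSquare T L R S) (X : A') (a₁ : A) (α : X ⟶ T.obj a₁)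
    (h : ∀ (a : A) (f : X ⟶ T.obj a), ∃! g : a₁ ⟶ a, α ≫ T.map g = f)
    (h' : ∀ (b : B) (f : R.obj X ⟶ S.obj b),
      ∃! g : L.obj a₁ ⟶ b, (R.map α ≫ w.natTrans.app a₁) ≫ S.map g = f) :
    (w.structuredArrowDownwards X).Initial := by
  obtain ⟨i⟩ := isInitial_of_existsUnique (StructuredArrow.mk α) h
  obtain ⟨j⟩ := isInitial_of_existsUnique
    ((w.structuredArrowDownwards X).obj (StructuredArrow.mk α)) h'
  exact initial_of w X _ i j

theorem main_sq {T : A ⥤ A'} {L : A ⥤ B} {R : A' ⥤ B'} {S : B ⥤ B'}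
    [L.Full] [L.Faithful] [R.Full] [R.Faithful]
    (w : TwoSquare T L R S)
    (hG : w.GuitartExact) (hcov : ∀ b', (∃ b, S.obj b = b') ∨ ∃ a, R.obj a = b') (Y : B' ⥤ C)
    (hpt : ∀ b, Nonempty (((LeftExtension.mk Y (𝟙 (R ⋙ Y))).compTwoSquare
        w).IsPointwiseLeftKanExtensionAt b) ↔
      Nonempty ((LeftExtension.mk (S ⋙ Y) (𝟙 (L ⋙ S ⋙ Y))).IsPointwiseLeftKanExtensionAt b)) :
    (R.lan (H := C)).essImage Y ↔ (L.lan (H := C)).essImage (S ⋙ Y) := by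
  rw [essImage_lan_iff, essImage_lan_iff]
  have key := fun b => (hpt b).symm.trans
    ((LeftExtension.mk Y (𝟙 (R ⋙ Y))).nonempty_isPointwiseLeftKanExtensionAt_compTwoSquare_iff w b)
  constructor
  · intro h b
    exact (key b).2 (h _)
  · intro h b'
    obtain ⟨b, rfl⟩ | ⟨a, rfl⟩ := hcov b'
    · exact (key b).1 (h b)
    · exact pointwise_at_image R Y a

end sq

section ff
variable {A B : Type} [SmallCategory A] [SmallCategory B] (u : A ⥤ B)

instance [u.Full] (a₀ : A) : (extTgt u a₀).Full where
  map_surjective {x y} f := by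
    cases x <;> cases y
    · exact ⟨PUnit.unit, rfl⟩
    · exact u.map_surjective f
    · exact f.elim
    · exact u.map_surjective f

instance [u.Faithful] (a₀ : A) : (extTgt u a₀).Faithful where
  map_injective {x y} f g h := by
    cases x <;> cases y
    · rfl
    · exact u.map_injective h
    · exact f.elim
    · exact u.map_injective h

instance [u.Full] (a₀ : A) : (extSrc u a₀).Full where
  map_surjective {x y} f := by
    cases x <;> cases y
    · exact ⟨PUnit.unit, rfl⟩
    · exact f.elim
    · exact u.map_surjective f
    · exact u.map_surjective f

instance [u.Faithful] (a₀ : A) : (extSrc u a₀).Faithful where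
  map_injective {x y} f g h := by
    cases x <;> cases y
    · rfl
    · exact f.elim
    · exact u.map_injective h
    · exact u.map_injective h

/-- target square -/
def sqTgt (a₀ : A) : TwoSquare (jTgt A a₀) u (extTgt u a₀) (jTgt B (u.obj a₀)) :=
  TwoSquare.mk _ _ _ _ (𝟙 (u ⋙ jTgt B (u.obj a₀)))

/-- source square -/
def sqSrc (a₀ : A) : TwoSquare (jSrc A a₀) u (extSrc u a₀) (jSrc B (u.obj a₀)) :=
  TwoSquare.mk _ _ _ _ (𝟙 (u ⋙ jSrc B (u.obj a₀)))

theorem sqTgt_exact (a₀ : A) : (sqTgt u a₀).GuitartExact := by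
  rw [TwoSquare.guitartExact_iff_initial]
  rintro (_ | a)
  · refine initial_of' (sqTgt u a₀) (ExtTgt.star A a₀) a₀ (newTgt A a₀) ?_ ?_
    · intro (x : A) (f : a₀ ⟶ x)
      exact ⟨f, Category.id_comp (obj := A) f, fun g hg => (Category.id_comp (obj := A) g).symm.trans hg⟩
    · intro (x : B) (f : u.obj a₀ ⟶ x)
      have key : ∀ g : u.obj a₀ ⟶ x, (u.map (𝟙 a₀) ≫ 𝟙 (u.obj a₀)) ≫ g = g := by simp
      exact ⟨f, key f, fun g hg => (key g).symm.trans hg⟩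
  · refine initial_of' (sqTgt u a₀) ((jTgt A a₀).obj a) a (𝟙 _) ?_ ?_
    · intro (x : A) (f : a ⟶ x)
      exact ⟨f, Category.id_comp (obj := A) f, fun g hg => (Category.id_comp (obj := A) g).symm.trans hg⟩
    · intro (x : B) (f : u.obj a ⟶ x)
      have key : ∀ g : u.obj a ⟶ x, (u.map (𝟙 a) ≫ 𝟙 (u.obj a)) ≫ g = g := by simp
      exact ⟨f, key f, fun g hg => (key g).symm.trans hg⟩

theorem sqSrc_exact (a₀ : A) : (sqSrc u a₀).GuitartExact := by
  rw [TwoSquare.guitartExact_iff_initial]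
  rintro (_ | a)
  · change ((sqSrc u a₀).structuredArrowDownwards (ExtSrc.star A a₀)).Initial
    exact ⟨fun t => (show PEmpty from t.hom).elim⟩
  · refine initial_of' (sqSrc u a₀) ((jSrc A a₀).obj a) a (𝟙 _) ?_ ?_
    · intro (x : A) (f : a ⟶ x)
      exact ⟨f, Category.id_comp (obj := A) f, fun g hg => (Category.id_comp (obj := A) g).symm.trans hg⟩
    · intro (x : B) (f : u.obj a ⟶ x)
      have key : ∀ g : u.obj a ⟶ x, (u.map (𝟙 a) ≫ 𝟙 (u.obj a)) ≫ g = g := by simp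
      exact ⟨f, key f, fun g hg => (key g).symm.trans hg⟩

end ff

end OnePointProof

/-- for a one-point extension `u' : A' ⟶ B'` of a fully faithful functor
`u : A ⟶ B` (in either orientation) and a category `C` with all small colimits, `u'` is
fully faithful and a functor `Y' : B' ⟶ C` lies in the essential image of the left Kan
extension functor along `u'` if and only if `Y' ∘ j_B` lies in the essential image of the
left Kan extension functor along `u`. -/
theorem stmt_19 {A B : Type} [SmallCategory A] [SmallCategory B] (u : A ⥤ B)
    [u.Full] [u.Faithful] (a₀ : A) (C : Type*) [Category C]
    [Limits.HasColimitsOfSize.{0, 0} C] :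
    ((OnePoint.extTgt u a₀).Full ∧ (OnePoint.extTgt u a₀).Faithful ∧
      ∀ Y' : OnePoint.ExtTgt B (u.obj a₀) ⥤ C,
        ((OnePoint.extTgt u a₀).lan (H := C)).essImage Y' ↔
          (u.lan (H := C)).essImage (OnePoint.jTgt B (u.obj a₀) ⋙ Y')) ∧
    ((OnePoint.extSrc u a₀).Full ∧ (OnePoint.extSrc u a₀).Faithful ∧
      ∀ Y' : OnePoint.ExtSrc B (u.obj a₀) ⥤ C,
        ((OnePoint.extSrc u a₀).lan (H := C)).essImage Y' ↔
          (u.lan (H := C)).essImage (OnePoint.jSrc B (u.obj a₀) ⋙ Y')) := by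
  refine ⟨⟨inferInstance, inferInstance, fun Y' => ?_⟩, ⟨inferInstance, inferInstance, fun Y' => ?_⟩⟩
  · refine OnePointProof.main_sq (OnePointProof.sqTgt u a₀) (OnePointProof.sqTgt_exact u a₀) ?_ Y' ?_
    · rintro (_ | b)
      · exact Or.inr ⟨OnePoint.ExtTgt.star A a₀, rfl⟩
      · exact Or.inl ⟨b, rfl⟩
    · intro b
      refine Equiv.nonempty_congr (Limits.IsColimit.equivIsoColimit
        (Limits.Cocone.ext (Iso.refl _) ?_))
      intro j
      exact (Category.comp_id _).trans (OnePointProof.comp_aux Y'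
        ((OnePoint.jTgt B (u.obj a₀)).map j.hom))
  · refine OnePointProof.main_sq (OnePointProof.sqSrc u a₀) (OnePointProof.sqSrc_exact u a₀) ?_ Y' ?_
    · rintro (_ | b)
      · exact Or.inr ⟨OnePoint.ExtSrc.star A a₀, rfl⟩
      · exact Or.inl ⟨b, rfl⟩
    · intro b
      refine Equiv.nonempty_congr (Limits.IsColimit.equivIsoColimit
        (Limits.Cocone.ext (Iso.refl _) ?_))
      intro j
      exact (Category.comp_id _).trans (OnePointProof.comp_aux Y'
        ((OnePoint.jSrc B (u.obj a₀)).map j.hom))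
end
end
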